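/- Let n ≥ 1 and let R be the polynomial ring over ℝ in the 2·(2^n − 1) indeterminates c_K, d_K indexed by the nonempty subsets K ⊆ Fin n; set c_∅ := 1 and d_∅ := 1. In the ring of multivariate formal power series R[[X_1,…,X_n]], let F := (∑_{K ⊆ Fin n} c_K · X^K) · (∑_{K ⊆ Fin n} d_K · X^K)^{−1}, where X^K := ∏_{i∈K} X_i (the inverse exists since the constant term is 1). Then the coefficient of X_1·X_2⋯X_n in F satisfies: (coefficient of X^{Fin n} in F) − (c_{Fin n} − d_{Fin n}) ∈ the ideal of R generated by {c_K : ∅ ≠ K ⊊ Fin n} ∪ {d_K : ∅ ≠ K ⊊ Fin n}. -/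

import Mathlib

open Finset MvPolynomial

/-- `c_K` as a polynomial variable for nonempty `K`, with `c_∅ := 1`. -/
noncomputable def cVar (n : ℕ) (K : Finset (Fin n)) :
    MvPolynomial ({K : Finset (Fin n) // K.Nonempty} ⊕
      {K : Finset (Fin n) // K.Nonempty}) ℝ :=
  if h : K.Nonempty then MvPolynomial.X (Sum.inl ⟨K, h⟩) else 1

/-- `d_K` as a polynomial variable for nonempty `K`, with `d_∅ := 1`. -/
noncomputable def dVar (n : ℕ) (K : Finset (Fin n)) :
    MvPolynomial ({K : Finset (Fin n) // K.Nonempty} ⊕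
      {K : Finset (Fin n) // K.Nonempty}) ℝ :=
  if h : K.Nonempty then MvPolynomial.X (Sum.inr ⟨K, h⟩) else 1

/-- The multivariate power series
`(∑_{K ⊆ Fin n} c_K X^K) / (∑_{K ⊆ Fin n} d_K X^K)`. -/
noncomputable def ratioSeriesMv (n : ℕ) :
    MvPowerSeries (Fin n) (MvPolynomial ({K : Finset (Fin n) // K.Nonempty} ⊕
      {K : Finset (Fin n) // K.Nonempty}) ℝ) :=
  (∑ K : Finset (Fin n),
      MvPowerSeries.monomial (∑ i ∈ K, Finsupp.single i 1) (cVar n K)) *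
    MvPowerSeries.invOfUnit
      (∑ K : Finset (Fin n),
        MvPowerSeries.monomial (∑ i ∈ K, Finsupp.single i 1) (dVar n K)) 1

/-- If `f` kills every proper nonempty subset and `f ∅ = 1`, the generating sum has two terms. -/
theorem sum_two_terms (n : ℕ) (hn : 1 ≤ n) {A : Type*} [CommRing A]
    (f : Finset (Fin n) → A) (h1 : f ∅ = 1)
    (h0 : ∀ K : Finset (Fin n), K.Nonempty → K ≠ Finset.univ → f K = 0) :
    (∑ K : Finset (Fin n),
      MvPowerSeries.monomial (∑ i ∈ K, Finsupp.single i 1) (f K)) =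
    1 + MvPowerSeries.monomial (∑ i : Fin n, Finsupp.single i 1) (f Finset.univ) := by
  have hne : (∅ : Finset (Fin n)) ≠ Finset.univ := by
    intro h
    have := Finset.mem_univ (⟨0, hn⟩ : Fin n)
    rw [← h] at this
    simp at this
  rw [Finset.sum_eq_add (∅ : Finset (Fin n)) Finset.univ hne]
  · rw [h1, Finset.sum_empty]
    rfl
  · intro K _ hK
    rw [h0 K (Finset.nonempty_iff_ne_empty.2 hK.1) hK.2, map_zero]
  · simp
  · simp

theorem ratio_coeff_mod_lower_mv (n : ℕ) (hn : 1 ≤ n) :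
    MvPowerSeries.coeff (∑ i : Fin n, Finsupp.single i 1) (ratioSeriesMv n) -
        (MvPolynomial.X (Sum.inl ⟨Finset.univ, ⟨⟨0, hn⟩, Finset.mem_univ _⟩⟩) -
          MvPolynomial.X (Sum.inr ⟨Finset.univ, ⟨⟨0, hn⟩, Finset.mem_univ _⟩⟩))
      ∈ Ideal.span
          {P | ∃ K : {K : Finset (Fin n) // K.Nonempty}, K.1 ≠ Finset.univ ∧
            (P = MvPolynomial.X (Sum.inl K) ∨ P = MvPolynomial.X (Sum.inr K))} := by
  classical
  set I := Ideal.span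
          {P : MvPolynomial ({K : Finset (Fin n) // K.Nonempty} ⊕
            {K : Finset (Fin n) // K.Nonempty}) ℝ |
            ∃ K : {K : Finset (Fin n) // K.Nonempty}, K.1 ≠ Finset.univ ∧
            (P = MvPolynomial.X (Sum.inl K) ∨ P = MvPolynomial.X (Sum.inr K))} with hI
  have hU : (Finset.univ : Finset (Fin n)).Nonempty := ⟨⟨0, hn⟩, Finset.mem_univ _⟩
  have he : (∑ i : Fin n, Finsupp.single i 1 : Fin n →₀ ℕ) ≠ 0 := by
    intro h
    have := DFunLike.congr_fun h (⟨0, hn⟩ : Fin n)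
    simp [Finsupp.finsetSum_apply, Finsupp.single_apply] at this
  let q := Ideal.Quotient.mk I
  have hc := sum_two_terms n hn (fun K => q (cVar n K)) (by simp [cVar]) (by
    intro K hK hK'
    simp only [cVar, hK, dif_pos]
    exact Ideal.Quotient.eq_zero_iff_mem.2 (Ideal.subset_span ⟨⟨K, hK⟩, hK', Or.inl rfl⟩))
  have hd := sum_two_terms n hn (fun K => q (dVar n K)) (by simp [dVar]) (by
    intro K hK hK'
    simp only [dVar, hK, dif_pos]
    exact Ideal.Quotient.eq_zero_iff_mem.2 (Ideal.subset_span ⟨⟨K, hK⟩, hK', Or.inr rfl⟩))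
  have hD0 : MvPowerSeries.constantCoeff (∑ K : Finset (Fin n),
        MvPowerSeries.monomial (∑ i ∈ K, Finsupp.single i 1) (dVar n K)) =
        ((1 : (MvPolynomial ({K : Finset (Fin n) // K.Nonempty} ⊕
      {K : Finset (Fin n) // K.Nonempty}) ℝ)ˣ) : MvPolynomial _ ℝ) := by
    rw [map_sum, Finset.sum_eq_single ∅]
    · simp [dVar]
    · intro K _ hK
      obtain ⟨j, hj⟩ := Finset.nonempty_iff_ne_empty.2 hK
      rw [← MvPowerSeries.coeff_zero_eq_constantCoeff_apply, MvPowerSeries.coeff_monomial, if_neg]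
      intro h
      have := DFunLike.congr_fun h j
      simp [Finsupp.finsetSum_apply, Finsupp.single_apply, hj] at this
    · simp
  have key : ratioSeriesMv n * (∑ K : Finset (Fin n),
        MvPowerSeries.monomial (∑ i ∈ K, Finsupp.single i 1) (dVar n K)) =
      (∑ K : Finset (Fin n),
        MvPowerSeries.monomial (∑ i ∈ K, Finsupp.single i 1) (cVar n K)) := by
    rw [ratioSeriesMv, mul_assoc, MvPowerSeries.invOfUnit_mul _ _ hD0, mul_one]
  have key2 := congrArg (MvPowerSeries.map q) key
  rw [map_mul, map_sum, map_sum] at key2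
  simp only [MvPowerSeries.map_monomial] at key2
  rw [hc, hd, mul_add, mul_one] at key2
  have k0 := congrArg (MvPowerSeries.coeff 0) key2
  have ke := congrArg (MvPowerSeries.coeff (0 + ∑ i : Fin n, Finsupp.single i 1)) key2
  rw [map_add, MvPowerSeries.coeff_add_mul_monomial, map_add, zero_add,
    MvPowerSeries.coeff_monomial_same, MvPowerSeries.coeff_one, if_neg he, zero_add] at ke
  have hz : MvPowerSeries.coeff 0 (MvPowerSeries.map q (ratioSeriesMv n)) = 1 := by
    have hm : ∀ a : _ ⧸ I, MvPowerSeries.constantCoeff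
        (MvPowerSeries.monomial (∑ i : Fin n, Finsupp.single i 1) a) = 0 := by
      intro a
      rw [← MvPowerSeries.coeff_zero_eq_constantCoeff_apply, MvPowerSeries.coeff_monomial,
        if_neg he.symm]
    simpa [hm] using k0
  rw [hz, one_mul, MvPowerSeries.coeff_map] at ke
  simp only [cVar, dVar, hU, dif_pos] at ke
  rw [← Ideal.Quotient.eq_zero_iff_mem, map_sub, map_sub]
  linear_combination ke
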